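/- arXiv:1405.6805 — 2 statements merged into one kernel-verified Lean document; each statement's English description precedes it below -/
import Mathlib

section
/- For each p ≥ 2 and any measurable test T : ℝ^p → [0,1], for β ∈ ℝ^p define Level(T) = ∫ T dN(0, I_p) and, for β with exactly one nonzero entry c, define AveragePower(T, β) = (1/p) Σ_{j=1}^p ∫ T dN(c e_j, I_p), the power averaged over the p vectors obtained by permuting the entries of β. Let B_p(ν) be the set of vectors β ∈ ℝ^p with exactly one nonzero entry, that entry having absolute value at most ν. If (ν_p) is a sequence of positive reals with √(2 log p) − ν_p → ∞ as p → ∞, then sup over all measurable tests T : ℝ^p → [0,1] and all β ∈ B_p(ν_p) of |AveragePower(T, β) − Level(T)| → 0 as p → ∞. -/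
open MeasureTheory ProbabilityTheory Filter Real

/-- The Gaussian measure `N(m, I_p)` on `ℝ^p` with mean vector `m` and identity covariance,
as the product of one-dimensional Gaussians. -/
noncomputable def gaussianPi (p : ℕ) (m : Fin p → ℝ) : Measure (Fin p → ℝ) :=
  Measure.pi fun j => gaussianReal (m j) 1

/-- A measurable `[0,1]`-valued test on `ℝ^p`. -/
def IsTest (p : ℕ) (T : (Fin p → ℝ) → ℝ) : Prop :=
  Measurable T ∧ ∀ x, T x ∈ Set.Icc (0 : ℝ) 1

/-- The power of the test `T` against the one-spike alternative with nonzero entry `c`,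
averaged over the `p` vectors `c e_j`, `j = 1, …, p`, obtained by permuting the entries:
`AveragePower(T, β) = (1/p) ∑_j ∫ T dN(c e_j, I_p)`. -/
noncomputable def averagePower (p : ℕ) (T : (Fin p → ℝ) → ℝ) (c : ℝ) : ℝ :=
  (1 / (p : ℝ)) * ∑ j : Fin p, ∫ x, T x ∂(gaussianPi p (Pi.single j c))


noncomputable def LR (c x : ℝ) : ℝ := Real.exp (c * x - c ^ 2 / 2)

lemma LR_meas (c : ℝ) : Measurable (LR c) := by unfold LR; fun_prop

lemma LR_pos (c x : ℝ) : 0 < LR c x := Real.exp_pos _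

lemma gauss_density (c : ℝ) : gaussianReal c 1 =
    (gaussianReal 0 1).withDensity (fun x => ENNReal.ofReal (LR c x)) := by
  rw [gaussianReal_of_var_ne_zero _ one_ne_zero, gaussianReal_of_var_ne_zero _ one_ne_zero,
    ← withDensity_mul _ (measurable_gaussianPDF _ _) (LR_meas c).ennreal_ofReal]
  congr 1
  ext x
  simp only [Pi.mul_apply, gaussianPDF_def]
  rw [← ENNReal.ofReal_mul (gaussianPDFReal_nonneg _ _ _)]
  congr 1
  simp only [gaussianPDFReal, LR]
  rw [mul_assoc _ (Real.exp _) (Real.exp _), ← Real.exp_add]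
  congr 2
  simp
  ring

lemma pi_density (p : ℕ) (j : Fin p) (c : ℝ) : gaussianPi p (Pi.single j c) =
    (gaussianPi p 0).withDensity (fun x => ENNReal.ofReal (LR c (x j))) := by
  unfold gaussianPi
  apply Measure.pi_eq
  intro s hs
  rw [withDensity_apply _ (MeasurableSet.univ_pi hs), Measure.restrict_pi_pi]
  have h := (lintegral_map (μ := Measure.pi fun i => (gaussianReal ((0 : Fin p → ℝ) i) 1).restrict (s i))
    (LR_meas c).ennreal_ofReal (measurable_pi_apply j))
  change _ = ∫⁻ a : Fin p → ℝ, ENNReal.ofReal (LR c (a j)) ∂_ at h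
  rw [← h]
  have h2 := Measure.pi_map_eval (fun i => (gaussianReal ((0 : Fin p → ℝ) i) 1).restrict (s i)) j
  change Measure.map (fun a : Fin p → ℝ => a j) _ = _ at h2
  rw [h2, lintegral_smul_measure, ← Finset.prod_erase_mul _ _ (Finset.mem_univ j)]
  simp only [Pi.single_eq_same, smul_eq_mul]
  congr 1
  · refine Finset.prod_congr rfl fun i hi => ?_
    rw [Pi.single_eq_of_ne (Finset.ne_of_mem_erase hi)]
    simp
  · rw [gauss_density c, withDensity_apply _ (hs j)]
    rfl

lemma int_exp (a b : ℝ) : Integrable (fun x => Real.exp (a * x + b)) (gaussianReal 0 1) ∧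
    ∫ x, Real.exp (a * x + b) ∂(gaussianReal 0 1) = Real.exp (a ^ 2 / 2 + b) := by
  simp only [Real.exp_add]
  refine ⟨(integrable_exp_mul_gaussianReal a).mul_const _, ?_⟩
  rw [integral_mul_const]
  have := congrFun (mgf_id_gaussianReal (μ := 0) (v := 1)) a
  simp only [mgf, id] at this
  rw [this]
  simp

lemma LR_int (c : ℝ) : Integrable (LR c) (gaussianReal 0 1) ∧
    ∫ x, LR c x ∂(gaussianReal 0 1) = 1 := by
  have := int_exp c (-(c ^ 2 / 2))
  have e : LR c = fun x => Real.exp (c * x + -(c ^ 2 / 2)) := rfl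
  rw [e]
  simpa using this

/-- truncated likelihood ratio -/
noncomputable def LA (c t x : ℝ) : ℝ := if c * x ≤ |c| * t then LR c x else 0

lemma LA_meas (c t : ℝ) : Measurable (LA c t) := by
  unfold LA
  exact Measurable.ite (measurableSet_le (by fun_prop) (by fun_prop)) (LR_meas c) measurable_const

lemma LA_nonneg (c t x : ℝ) : 0 ≤ LA c t x := by
  unfold LA; split_ifs; exacts [(LR_pos c x).le, le_rfl]

lemma LA_le (c t x : ℝ) : LA c t x ≤ LR c x := by
  unfold LA; split_ifs; exacts [le_rfl, (LR_pos c x).le]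

lemma LA_bd (c t x : ℝ) : LA c t x ≤ Real.exp (|c| * t - c ^ 2 / 2) := by
  unfold LA; split_ifs with h
  · exact Real.exp_le_exp.2 (by linarith)
  · positivity

lemma LA_memLp (c t : ℝ) : MemLp (LA c t) 2 (gaussianReal 0 1) :=
  MemLp.of_bound (LA_meas c t).aestronglyMeasurable (Real.exp (|c| * t - c ^ 2 / 2))
    (ae_of_all _ fun x => by
      rw [Real.norm_of_nonneg (LA_nonneg c t x)]; exact LA_bd c t x)

lemma LA_var (c t : ℝ) : Var[LA c t; gaussianReal 0 1] ≤ Real.exp (|c| * t - c ^ 2 / 2) := by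
  refine (variance_le_expectation_sq (LA_meas c t).aestronglyMeasurable).trans ?_
  calc ∫ x, (LA c t ^ 2) x ∂(gaussianReal 0 1)
      ≤ ∫ x, Real.exp (|c| * t - c ^ 2 / 2) * LR c x ∂(gaussianReal 0 1) := by
        refine integral_mono (LA_memLp c t).integrable_sq ((LR_int c).1.const_mul _) fun x => ?_
        rw [Pi.pow_apply, sq (LA c t x)]
        exact mul_le_mul (LA_bd c t x) (LA_le c t x) (LA_nonneg c t x) (Real.exp_pos _).le
    _ = _ := by rw [integral_const_mul, (LR_int c).2, mul_one]

lemma LB_int (c t : ℝ) (hc : c ≠ 0) (hct : |c| ≤ t) :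
    ∫ x, (LR c x - LA c t x) ∂(gaussianReal 0 1) ≤ Real.exp (-(t - |c|) ^ 2 / 2) := by
  have hc0 : 0 < |c| := abs_pos.2 hc
  set d := t - |c| with hd
  have hd0 : 0 ≤ d := by linarith
  have h1 := int_exp (c + d * (c / |c|)) (- (c ^ 2 / 2) - d * t)
  have key : (c + d * (c / |c|)) ^ 2 / 2 + (- (c ^ 2 / 2) - d * t) = -d ^ 2 / 2 := by
    have e : c ^ 2 = |c| ^ 2 := (sq_abs c).symm
    have : (c + d * (c / |c|)) ^ 2 = (|c| + d) ^ 2 := by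
      have : c + d * (c / |c|) = c / |c| * (|c| + d) := by field_simp
      rw [this, mul_pow, div_pow, sq_abs, div_self (by positivity), one_mul]
    rw [this, e]
    have : t = d + |c| := by rw [hd]; ring
    rw [this]; ring
  rw [key] at h1
  rw [← h1.2]
  refine integral_mono ((LR_int c).1.sub ((LA_memLp c t).integrable one_le_two)) h1.1 fun x => ?_
  simp only [LA]
  split_ifs with h
  · simp; positivity
  · rw [sub_zero, LR]
    apply Real.exp_le_exp.2
    have : t ≤ c / |c| * x := by
      rw [div_mul_eq_mul_div, le_div_iff₀ hc0]; linarith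
    nlinarith [mul_le_mul_of_nonneg_left this hd0]

instance gp_prob (p : ℕ) (m : Fin p → ℝ) : IsProbabilityMeasure (gaussianPi p m) := by
  unfold gaussianPi; infer_instance

lemma gp_int (p : ℕ) (j : Fin p) {f : ℝ → ℝ} (hf : Integrable f (gaussianReal 0 1)) :
    Integrable (fun x : Fin p → ℝ => f (x j)) (gaussianPi p 0) ∧
    ∫ x, f (x j) ∂(gaussianPi p 0) = ∫ x, f x ∂(gaussianReal 0 1) :=
  ⟨integrable_comp_eval (μ := fun _ : Fin p => gaussianReal 0 1) hf,
   integral_comp_eval (μ := fun _ : Fin p => gaussianReal 0 1) hf.aestronglyMeasurable⟩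

lemma gp_shift (p : ℕ) (j : Fin p) (c : ℝ) (T : (Fin p → ℝ) → ℝ) :
    ∫ x, T x ∂(gaussianPi p (Pi.single j c)) =
      ∫ x, LR c (x j) * T x ∂(gaussianPi p 0) := by
  rw [pi_density, integral_withDensity_eq_integral_toReal_smul]
  · simp only [smul_eq_mul, ENNReal.toReal_ofReal (LR_pos c _).le]
  · exact ((LR_meas c).comp (measurable_pi_apply j)).ennreal_ofReal
  · exact ae_of_all _ fun _ => ENNReal.ofReal_lt_top

lemma U_bound (p : ℕ) (hp : 1 ≤ p) (c : ℝ) :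
    ∫ x, |(1 / (p : ℝ)) * ∑ j : Fin p, LA c (√(2 * Real.log p)) (x j)
      - ∫ y, LA c (√(2 * Real.log p)) y ∂(gaussianReal 0 1)| ∂(gaussianPi p 0)
    ≤ √(Real.exp (-(√(2 * Real.log p) - |c|) ^ 2 / 2)) := by
  set t := √(2 * Real.log p) with ht
  have hp0 : (0 : ℝ) < p := by exact_mod_cast hp
  have ht2 : t ^ 2 = 2 * Real.log p :=
    Real.sq_sqrt (mul_nonneg two_pos.le (Real.log_nonneg (by exact_mod_cast hp)))
  set m := ∫ y, LA c t y ∂(gaussianReal 0 1) with hm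
  set V : (Fin p → ℝ) → ℝ := fun x => (1 / (p : ℝ)) * (∑ j : Fin p, fun x : Fin p → ℝ => LA c t (x j)) x with hV
  have hmem : ∀ j : Fin p, MemLp (fun x : Fin p → ℝ => LA c t (x j)) 2 (gaussianPi p 0) := fun j =>
    (LA_memLp c t).comp_measurePreserving (measurePreserving_eval (fun _ : Fin p => gaussianReal 0 1) j)
  have hVmem : MemLp V 2 (gaussianPi p 0) := (memLp_finsetSum' _ fun j _ => hmem j).const_mul _
  have hVint : ∫ x, V x ∂(gaussianPi p 0) = m := by
    simp only [hV, Finset.sum_apply]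
    rw [integral_const_mul, integral_finsetSum _ fun j _ => (hmem j).integrable one_le_two]
    rw [Finset.sum_congr rfl fun j _ => (gp_int p j ((LA_memLp c t).integrable one_le_two)).2]
    simp only [Finset.sum_const, Finset.card_univ, Fintype.card_fin, nsmul_eq_mul, ← hm]
    field_simp
  have hvar : Var[V; gaussianPi p 0] ≤ Real.exp (-(t - |c|) ^ 2 / 2) := by
    rw [hV, variance_const_mul]
    have := variance_sum_pi (μ := fun _ : Fin p => gaussianReal 0 1)
      (X := fun _ => LA c t) (fun _ => LA_memLp c t)
    have h2 : Var[∑ j : Fin p, fun x : Fin p → ℝ => LA c t (x j); gaussianPi p 0]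
        = ∑ j : Fin p, Var[LA c t; gaussianReal 0 1] := this
    rw [h2]
    simp only [Finset.sum_const, Finset.card_univ, Fintype.card_fin, nsmul_eq_mul]
    have e : Real.exp (-(t - |c|) ^ 2 / 2) = Real.exp (|c| * t - c ^ 2 / 2) / p := by
      rw [← Real.exp_log hp0, ← Real.exp_sub]
      congr 1
      rw [← sq_abs c]
      linarith [show (t - |c|) ^ 2 = t ^ 2 - 2 * (|c| * t) + |c| ^ 2 by ring]
    rw [e]
    calc (1 / (p : ℝ)) ^ 2 * (p * Var[LA c t; gaussianReal 0 1])
        = Var[LA c t; gaussianReal 0 1] / p := by field_simp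
      _ ≤ _ := by gcongr; exact LA_var c t
  apply Real.le_sqrt_of_sq_le
  refine le_trans ?_ hvar
  have hU : MemLp (fun x => |V x - m|) 2 (gaussianPi p 0) := (hVmem.sub (memLp_const m)).abs
  have hn := variance_nonneg (fun x => |V x - m|) (gaussianPi p 0)
  rw [variance_eq_sub hU] at hn
  rw [variance_eq_integral hVmem.aemeasurable, hVint]
  have e1 : ∫ x, |(1 / (p : ℝ)) * ∑ j : Fin p, LA c t (x j) - m| ∂(gaussianPi p 0)
      = ∫ x, |V x - m| ∂(gaussianPi p 0) := by simp [hV, Finset.sum_apply]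
  rw [e1]
  simp only [Pi.pow_apply, sq_abs] at hn
  linarith

lemma main_bound (p : ℕ) (hp : 1 ≤ p) (c : ℝ) (hc : c ≠ 0) (hct : |c| ≤ √(2 * Real.log p))
    (T : (Fin p → ℝ) → ℝ) (hT : IsTest p T) :
    |averagePower p T c - ∫ x, T x ∂(gaussianPi p 0)| ≤
      √(Real.exp (-(√(2 * Real.log p) - |c|) ^ 2 / 2))
      + 2 * Real.exp (-(√(2 * Real.log p) - |c|) ^ 2 / 2) := by
  have hU := U_bound p hp c
  have hB := LB_int c _ hc hct
  set t := √(2 * Real.log p) with ht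
  set ε := Real.exp (-(t - |c|) ^ 2 / 2)
  have hp0 : (0 : ℝ) < p := by exact_mod_cast hp
  set m := ∫ y, LA c t y ∂(gaussianReal 0 1) with hm
  have hLAi := (LA_memLp c t).integrable one_le_two
  have hBi : Integrable (fun x => LR c x - LA c t x) (gaussianReal 0 1) := (LR_int c).1.sub hLAi
  have hbm : ∫ x, (LR c x - LA c t x) ∂(gaussianReal 0 1) = 1 - m := by
    rw [integral_sub (LR_int c).1 hLAi, (LR_int c).2]
  have hb0 : 0 ≤ 1 - m := by
    rw [← hbm]; exact integral_nonneg fun x => sub_nonneg.2 (LA_le c t x)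
  have hTb : ∀ x, ‖T x‖ ≤ 1 := fun x => by
    rw [Real.norm_of_nonneg (hT.2 x).1]; exact (hT.2 x).2
  have hTm : AEStronglyMeasurable T (gaussianPi p 0) := hT.1.aestronglyMeasurable
  have hTi : Integrable T (gaussianPi p 0) := Integrable.of_bound hTm 1 (ae_of_all _ hTb)
  have hLT : ∀ j : Fin p, Integrable (fun x => LR c (x j) * T x) (gaussianPi p 0) := fun j =>
    (gp_int p j (LR_int c).1).1.mul_bdd hTm (ae_of_all _ hTb)
  have e1 : averagePower p T c - ∫ x, T x ∂(gaussianPi p 0) =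
      ∫ x, ((1 / (p : ℝ)) * ∑ j : Fin p, LR c (x j) * T x - T x) ∂(gaussianPi p 0) := by
    rw [integral_sub _ hTi, integral_const_mul, integral_finsetSum _ fun j _ => hLT j]
    · simp only [averagePower, gp_shift]
    · exact (integrable_finsetSum _ fun j _ => hLT j).const_mul _
  rw [e1]
  have iA : Integrable (fun x => |(1 / (p : ℝ)) * ∑ j : Fin p, LA c t (x j) - m|)
      (gaussianPi p 0) :=
    (((integrable_finsetSum _ fun j _ => (gp_int p j hLAi).1).const_mul _).sub
      (integrable_const m)).abs
  have iB : Integrable (fun x => (1 / (p : ℝ)) * ∑ j : Fin p, (LR c (x j) - LA c t (x j)))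
      (gaussianPi p 0) :=
    (integrable_finsetSum _ fun j _ => (gp_int p j hBi).1).const_mul _
  have vB : ∫ x, (1 / (p : ℝ)) * ∑ j : Fin p, (LR c (x j) - LA c t (x j)) ∂(gaussianPi p 0)
      = 1 - m := by
    rw [integral_const_mul, integral_finsetSum _ fun j _ => (gp_int p j hBi).1]
    rw [Finset.sum_congr rfl fun j _ => (gp_int p j hBi).2, hbm]
    simp only [Finset.sum_const, Finset.card_univ, Fintype.card_fin, nsmul_eq_mul]
    field_simp
  have hle := norm_integral_le_of_norm_le (μ := gaussianPi p 0)
    (f := fun x => (1 / (p : ℝ)) * ∑ j : Fin p, LR c (x j) * T x - T x)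
    ((iA.add iB).add (integrable_const (1 - m))) (ae_of_all _ fun x => by
      have : (1 / (p : ℝ)) * ∑ j : Fin p, LR c (x j) * T x - T x =
          T x * (((1 / (p : ℝ)) * ∑ j : Fin p, LA c t (x j) - m) +
            (1 / (p : ℝ)) * ∑ j : Fin p, (LR c (x j) - LA c t (x j)) - (1 - m)) := by
        rw [← Finset.sum_mul, Finset.sum_sub_distrib]; ring
      rw [this, norm_mul]
      have hs : 0 ≤ (1 / (p : ℝ)) * ∑ j : Fin p, (LR c (x j) - LA c t (x j)) :=
        mul_nonneg (by positivity) (Finset.sum_nonneg fun j _ => sub_nonneg.2 (LA_le c t _))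
      refine (mul_le_of_le_one_left (norm_nonneg _) (hTb x)).trans ?_
      simp only [Pi.add_apply]
      rw [Real.norm_eq_abs]
      refine (abs_sub _ _).trans ?_
      refine add_le_add ((abs_add_le _ _).trans ?_) (abs_of_nonneg hb0).le
      exact add_le_add le_rfl (abs_of_nonneg hs).le)
  rw [Real.norm_eq_abs] at hle
  refine hle.trans ?_
  rw [integral_add' (iA.add iB) (integrable_const _), integral_add' iA iB, vB]
  simp only [integral_const, probReal_univ, smul_eq_mul, one_mul]
  linarith

/-- If `√(2 log p) − ν_p → ∞`, then over all measurable `[0,1]`-valued tests `T` and all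
one-spike alternatives `β ∈ B_p(ν_p)` (with nonzero entry `c`, `0 < |c| ≤ ν_p`),
`sup |AveragePower(T, β) − Level(T)| → 0`. -/
theorem stmt12 (ν : ℕ → ℝ) (hν : ∀ p, 0 < ν p)
    (hgap : Tendsto (fun p : ℕ => Real.sqrt (2 * Real.log p) - ν p) atTop atTop) :
    Tendsto
      (fun p : ℕ =>
        ⨆ q : {q : ((Fin p → ℝ) → ℝ) × ℝ //
            IsTest p q.1 ∧ q.2 ≠ 0 ∧ |q.2| ≤ ν p},
          |averagePower p q.1.1 q.1.2 - ∫ x, q.1.1 x ∂(gaussianPi p 0)|)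
      atTop (nhds 0) := by
  set e : ℕ → ℝ := fun p => Real.exp (-(√(2 * Real.log p) - ν p) ^ 2 / 2) with he
  have he0 : Tendsto e atTop (nhds 0) := by
    refine Real.tendsto_exp_atBot.comp ?_
    have h1 : Tendsto (fun p : ℕ => (√(2 * Real.log p) - ν p) ^ 2 / 2) atTop atTop :=
      ((tendsto_pow_atTop two_ne_zero).comp hgap).atTop_div_const two_pos
    refine (tendsto_neg_atTop_atBot.comp h1).congr fun p => ?_
    simp only [Function.comp]; ring
  have hb : Tendsto (fun p => √(e p) + 2 * e p) atTop (nhds 0) := by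
    simpa using he0.sqrt.add (he0.const_mul 2)
  refine squeeze_zero' (Eventually.of_forall fun p => Real.iSup_nonneg fun q => abs_nonneg _) ?_ hb
  filter_upwards [hgap.eventually_ge_atTop 0, eventually_ge_atTop 1] with p hp hp1
  refine Real.iSup_le (fun q => ?_) (by positivity)
  obtain ⟨⟨T, c⟩, hT, hc, hcν⟩ := q
  simp only at hT hc hcν ⊢
  refine (main_bound p hp1 c hc (by linarith) T hT).trans ?_
  have : Real.exp (-(√(2 * Real.log p) - |c|) ^ 2 / 2) ≤ e p := by
    apply Real.exp_le_exp.2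
    nlinarith
  gcongr
end

section
/- For each p ≥ 2, let 𝒮_p denote the class of measurable tests T : ℝ^p → [0,1] that are signed-permutation invariant, i.e., T(s_1 x_{σ(1)}, …, s_p x_{σ(p)}) = T(x_1, …, x_p) for every permutation σ of {1, …, p}, every choice of signs s_j ∈ {−1, +1}, and every x ∈ ℝ^p. For β ∈ ℝ^p define Power(T, β) = ∫ T dN(β, I_p) and Level(T) = ∫ T dN(0, I_p). Fix a constant Δ > 0. Then sup_{T ∈ 𝒮_p, β ∈ ℝ^p : ‖β‖₂ ≤ Δ} |Power(T, β) − Level(T)| → 0 as p → ∞. -/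
open MeasureTheory ProbabilityTheory Filter Real

/-- A measurable, `[0,1]`-valued, signed-permutation-invariant test on `ℝ^p`:
`T(s_1 x_{σ(1)}, …, s_p x_{σ(p)}) = T(x)` for all signs `s_j ∈ {−1, +1}` and
permutations `σ`. -/
def IsSignedPermInvariantTest (p : ℕ) (T : (Fin p → ℝ) → ℝ) : Prop :=
  Measurable T ∧ (∀ x, T x ∈ Set.Icc (0 : ℝ) 1) ∧
    ∀ σ : Equiv.Perm (Fin p), ∀ s : Fin p → ℝ, (∀ i, s i = 1 ∨ s i = -1) →
      ∀ x : Fin p → ℝ, T (fun i => s i * x (σ i)) = T x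

/-- likelihood ratio -/
noncomputable def lrat (p : ℕ) (m x : Fin p → ℝ) : ℝ := ∏ i, exp (m i * x i - m i ^ 2 / 2)

lemma gauss_one (m : ℝ) : gaussianReal m 1 =
    (gaussianReal 0 1).withDensity (fun x => ENNReal.ofReal (exp (m * x - m ^ 2 / 2))) := by
  rw [gaussianReal_of_var_ne_zero _ one_ne_zero, gaussianReal_of_var_ne_zero _ one_ne_zero,
    ← withDensity_mul _ (measurable_gaussianPDF 0 1) (by fun_prop)]
  congr 1
  ext x
  simp only [gaussianPDF, Pi.mul_apply]
  rw [← ENNReal.ofReal_mul (gaussianPDFReal_nonneg _ _ _)]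
  congr 1
  simp only [gaussianPDFReal]
  conv_rhs => rw [mul_assoc, ← Real.exp_add]
  congr 2
  simp
  ring

lemma gintegrable_one (m c d : ℝ) : Integrable (fun x => exp (c * x - d)) (gaussianReal m 1) := by
  have h := (integrable_exp_mul_gaussianReal (μ := m) (v := 1) c).mul_const (exp (-d))
  refine h.congr (ae_of_all _ fun x => ?_)
  simp only [← Real.exp_add, sub_eq_add_neg]

lemma gint_one (u v : ℝ) : ∫ x, exp ((u + v) * x - (u ^ 2 / 2 + v ^ 2 / 2)) ∂(gaussianReal 0 1)
    = exp (u * v) := by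
  have h := congrFun (mgf_fun_id_gaussianReal (μ := 0) (v := 1)) (u + v)
  simp only [mgf] at h
  simp_rw [sub_eq_add_neg, Real.exp_add]
  rw [integral_mul_const, h, ← Real.exp_add]
  congr 1
  simp
  ring

lemma lrat_mul (p : ℕ) (u v x : Fin p → ℝ) : lrat p u x * lrat p v x =
    ∏ i, exp ((u i + v i) * x i - (u i ^ 2 / 2 + v i ^ 2 / 2)) := by
  simp only [lrat, ← Finset.prod_mul_distrib, ← Real.exp_add]
  refine Finset.prod_congr rfl fun i _ => ?_
  congr 1; ring

instance (p : ℕ) (m : Fin p → ℝ) : IsProbabilityMeasure (gaussianPi p m) := by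
  unfold gaussianPi; infer_instance

lemma lrat_mul_integrable (p : ℕ) (u v : Fin p → ℝ) :
    Integrable (fun x => lrat p u x * lrat p v x) (gaussianPi p 0) := by
  simp_rw [lrat_mul]
  exact Integrable.fintype_prod (f := fun i y => exp ((u i + v i) * y - (u i ^ 2 / 2 + v i ^ 2 / 2)))
    (fun i => gintegrable_one _ _ _)

lemma lrat_mul_integral (p : ℕ) (u v : Fin p → ℝ) :
    ∫ x, lrat p u x * lrat p v x ∂(gaussianPi p 0) = exp (∑ i, u i * v i) := by
  simp_rw [lrat_mul]
  unfold gaussianPi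
  rw [integral_fintype_prod_eq_prod
    (f := fun i y => exp ((u i + v i) * y - (u i ^ 2 / 2 + v i ^ 2 / 2)))]
  simp only [Pi.zero_apply, gint_one, Real.exp_sum]

lemma lrat_zero (p : ℕ) (x : Fin p → ℝ) : lrat p 0 x = 1 := by simp [lrat]

lemma lrat_meas (p : ℕ) (u : Fin p → ℝ) : Measurable (lrat p u) := by
  unfold lrat; fun_prop

lemma lrat_nonneg (p : ℕ) (u x : Fin p → ℝ) : 0 ≤ lrat p u x :=
  Finset.prod_nonneg fun _ _ => (Real.exp_pos _).le

lemma lrat_integrable (p : ℕ) (u : Fin p → ℝ) : Integrable (lrat p u) (gaussianPi p 0) := by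
  simpa [lrat_zero] using lrat_mul_integrable p u 0

lemma lrat_integral (p : ℕ) (u : Fin p → ℝ) : ∫ x, lrat p u x ∂(gaussianPi p 0) = 1 := by
  simpa [lrat_zero] using lrat_mul_integral p u 0

lemma gaussianPi_eq (p : ℕ) (m : Fin p → ℝ) : gaussianPi p m =
    (gaussianPi p 0).withDensity (fun x => ENNReal.ofReal (lrat p m x)) := by
  conv_lhs => unfold gaussianPi
  refine Measure.pi_eq fun S hS => ?_
  rw [withDensity_apply _ (MeasurableSet.univ_pi hS), gaussianPi, Measure.restrict_pi_pi]
  have hi : ∀ i, Integrable (fun y => exp (m i * y - m i ^ 2 / 2))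
      ((gaussianReal ((0 : Fin p → ℝ) i) 1).restrict (S i)) :=
    fun i => (gintegrable_one _ _ _).restrict
  rw [← ofReal_integral_eq_lintegral_ofReal]
  · unfold lrat
    rw [integral_fintype_prod_eq_prod (f := fun i y => exp (m i * y - m i ^ 2 / 2)),
      ENNReal.ofReal_prod_of_nonneg (fun i _ => integral_nonneg fun _ => (Real.exp_pos _).le)]
    refine Finset.prod_congr rfl fun i _ => ?_
    rw [gauss_one (m i), withDensity_apply _ (hS i), ofReal_integral_eq_lintegral_ofReal (hi i)]
    · rfl
    · exact ae_of_all _ fun _ => (Real.exp_pos _).le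
  · exact Integrable.fintype_prod (f := fun i y => exp (m i * y - m i ^ 2 / 2)) hi
  · exact ae_of_all _ fun _ => lrat_nonneg _ _ _

lemma power_eq (p : ℕ) (m : Fin p → ℝ) (T : (Fin p → ℝ) → ℝ) :
    ∫ x, T x ∂(gaussianPi p m) = ∫ x, lrat p m x * T x ∂(gaussianPi p 0) := by
  rw [gaussianPi_eq, integral_withDensity_eq_integral_toReal_smul]
  · simp [ENNReal.toReal_ofReal (lrat_nonneg _ _ _)]
  · exact (lrat_meas p m).ennreal_ofReal
  · exact ae_of_all _ fun _ => ENNReal.ofReal_lt_top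

lemma power_inv (p : ℕ) (β : Fin p → ℝ) (T : (Fin p → ℝ) → ℝ)
    (hT : IsSignedPermInvariantTest p T) (σ : Equiv.Perm (Fin p)) (s : Fin p → ℝ)
    (hs : ∀ i, s i = 1 ∨ s i = -1) :
    ∫ x, T x ∂(gaussianPi p (fun i => s i * β (σ i))) = ∫ x, T x ∂(gaussianPi p β) := by
  have hm : Measurable (fun x : Fin p → ℝ => fun i => s i * x (σ i)) := by fun_prop
  have key : gaussianPi p (fun i => s i * β (σ i)) =
      (gaussianPi p β).map (fun x i => s i * x (σ i)) := by
    conv_lhs => unfold gaussianPi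
    refine Measure.pi_eq fun S hS => ?_
    rw [Measure.map_apply hm (MeasurableSet.univ_pi hS)]
    have : (fun (x : Fin p → ℝ) i => s i * x (σ i)) ⁻¹' (Set.univ.pi S) =
        Set.univ.pi (fun j => (fun y => s (σ.symm j) * y) ⁻¹' S (σ.symm j)) := by
      ext x
      simp only [Set.mem_preimage, Set.mem_pi, Set.mem_univ, true_imp_iff]
      constructor
      · intro h j; simpa using h (σ.symm j)
      · intro h i; simpa using h (σ i)
    rw [this, gaussianPi, Measure.pi_pi, ← Equiv.prod_comp σ]
    refine Finset.prod_congr rfl fun i _ => ?_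
    simp only [Equiv.symm_apply_apply]
    rw [← Measure.map_apply (by fun_prop) (hS i), gaussianReal_map_const_mul]
    congr 2
    rcases hs i with h | h <;> ext <;> simp [h]
  rw [key, integral_map hm.aemeasurable hT.1.aestronglyMeasurable]
  simp_rw [hT.2.2 σ s hs]

/-- sign -/
def sg (b : Bool) : ℝ := if b then 1 else -1

lemma sg_pm (b : Bool) : sg b = 1 ∨ sg b = -1 := by cases b <;> simp [sg]

lemma sg_sq (b : Bool) : sg b ^ 2 = 1 := by cases b <;> simp [sg]

/-- group orbit -/
def act (p : ℕ) (β : Fin p → ℝ) (g : Fin p × (Fin p → Bool)) : Fin p → ℝ :=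
  fun i => sg (g.2 i) * β (i + g.1)

lemma sgn_exp_sum (p : ℕ) (w : Fin p → ℝ) :
    ∑ b : Fin p → Bool, exp (∑ i, sg (b i) * w i) ≤ 2 ^ p * exp (∑ i, w i ^ 2 / 2) := by
  have h : ∑ b : Fin p → Bool, exp (∑ i, sg (b i) * w i) = ∏ i, ∑ c : Bool, exp (sg c * w i) := by
    rw [Finset.prod_univ_sum, Fintype.piFinset_univ]
    simp only [Real.exp_sum]
  rw [h, Real.exp_sum]
  have : (2 : ℝ) ^ p = ∏ i : Fin p, 2 := by simp
  rw [this, ← Finset.prod_mul_distrib]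
  refine Finset.prod_le_prod (fun i _ => by positivity) fun i _ => ?_
  have := Real.cosh_le_exp_half_sq (w i)
  rw [Real.cosh_eq] at this
  simp [sg]
  linarith

lemma orbit_sum (p : ℕ) [NeZero p] (β v : Fin p → ℝ) (A : ℝ) (hβ : ∑ i, β i ^ 2 ≤ A)
    (hv : ∑ i, v i ^ 2 ≤ A) :
    ∑ g, exp (∑ i, v i * act p β g i) ≤
      2 ^ p * (p + A ^ 2 / 2 * exp (A ^ 2 / 2)) := by
  have hA : 0 ≤ A := le_trans (Finset.sum_nonneg fun i _ => sq_nonneg _) hβ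
  rw [Fintype.sum_prod_type]
  have h1 : ∀ k : Fin p, ∑ b : Fin p → Bool, exp (∑ i, v i * act p β (k, b) i) ≤
      2 ^ p * (1 + (∑ i, v i ^ 2 * β (i + k) ^ 2) / 2 * exp (A ^ 2 / 2)) := by
    intro k
    have := sgn_exp_sum p (fun i => v i * β (i + k))
    have e : ∀ b : Fin p → Bool, ∑ i, v i * act p β (k, b) i
        = ∑ i, sg (b i) * (v i * β (i + k)) := fun b =>
      Finset.sum_congr rfl fun i _ => by simp [act]; ring
    simp_rw [e]
    refine this.trans ?_
    gcongr
    simp_rw [mul_pow]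
    rw [← Finset.sum_div]
    set X := ∑ i, v i ^ 2 * β (i + k) ^ 2 with hX
    have hX0 : 0 ≤ X := Finset.sum_nonneg fun i _ => by positivity
    have hXA : X ≤ A ^ 2 := by
      calc X ≤ ∑ i, v i ^ 2 * A := by
            refine Finset.sum_le_sum fun i _ => ?_
            gcongr
            exact (Finset.single_le_sum (f := fun j => β j ^ 2)
              (fun j _ => sq_nonneg _) (Finset.mem_univ (i + k))).trans hβ
        _ = (∑ i, v i ^ 2) * A := by rw [Finset.sum_mul]
        _ ≤ A * A := by gcongr
        _ = A ^ 2 := by ring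
    have h2 : 1 - X / 2 ≤ exp (-(X / 2)) := by linarith [Real.add_one_le_exp (-(X / 2))]
    have h3 : exp (X / 2) * exp (-(X / 2)) = 1 := by rw [← Real.exp_add]; simp
    have h4 : exp (X / 2) ≤ exp (A ^ 2 / 2) := by gcongr
    nlinarith [Real.exp_pos (X / 2)]
  refine (Finset.sum_le_sum fun k _ => h1 k).trans ?_
  rw [← Finset.mul_sum]
  gcongr
  rw [Finset.sum_add_distrib, ← Finset.sum_mul, ← Finset.sum_div, Finset.sum_comm]
  simp only [← Finset.mul_sum]
  have h5 : ∀ i : Fin p, ∑ k, β (i + k) ^ 2 = ∑ k, β k ^ 2 := fun i =>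
    Equiv.sum_comp (Equiv.addLeft i) (fun k => β k ^ 2)
  simp only [h5, ← Finset.sum_mul]
  have h6 : (∑ i, v i ^ 2) * ∑ k, β k ^ 2 ≤ A ^ 2 := by
    rw [sq]
    exact mul_le_mul hv hβ (Finset.sum_nonneg fun i _ => sq_nonneg _) hA
  simp only [Finset.sum_const, Finset.card_univ, Fintype.card_fin, nsmul_eq_mul, mul_one]
  gcongr

lemma act_sq (p : ℕ) [NeZero p] (β : Fin p → ℝ) (g) : ∑ i, act p β g i ^ 2 = ∑ i, β i ^ 2 := by
  simp only [act, mul_pow, sg_sq, one_mul]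
  exact Equiv.sum_comp (Equiv.addRight g.1) (fun k => β k ^ 2)

lemma diff_bound (p : ℕ) [NeZero p] (β : Fin p → ℝ) (A : ℝ) (hβ : ∑ i, β i ^ 2 ≤ A)
    (T : (Fin p → ℝ) → ℝ) (hT : IsSignedPermInvariantTest p T) :
    ((∫ x, T x ∂(gaussianPi p β)) - ∫ x, T x ∂(gaussianPi p 0)) ^ 2 ≤
      (A ^ 2 / 2 * exp (A ^ 2 / 2)) / p := by
  set D := (∫ x, T x ∂(gaussianPi p β)) - ∫ x, T x ∂(gaussianPi p 0) with hD
  set H : (Fin p → ℝ) → ℝ := fun x => ∑ g, (lrat p (act p β g) x - 1) with hH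
  set N : ℝ := p * 2 ^ p with hN
  have hcard : (Fintype.card (Fin p × (Fin p → Bool)) : ℝ) = N := by simp [hN]
  have hp : (0 : ℝ) < p := by exact_mod_cast Nat.pos_of_ne_zero (NeZero.ne p)
  have hTb : ∀ x, ‖T x‖ ≤ 1 := fun x => by
    rw [Real.norm_eq_abs, abs_of_nonneg (hT.2.1 x).1]; exact (hT.2.1 x).2
  have hTi : Integrable T (gaussianPi p 0) :=
    Integrable.of_bound hT.1.aestronglyMeasurable 1 (ae_of_all _ hTb)
  have hLT : ∀ u, Integrable (fun x => lrat p u x * T x) (gaussianPi p 0) := fun u =>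
    (lrat_integrable p u).mul_bdd hT.1.aestronglyMeasurable (ae_of_all _ hTb)
  have hDg : ∀ g, ∫ x, (lrat p (act p β g) x - 1) * T x ∂(gaussianPi p 0) = D := by
    intro g
    simp only [sub_mul, one_mul]
    rw [integral_sub (hLT _) hTi, ← power_eq, hD]
    congr 1
    exact power_inv p β T hT (Equiv.addRight g.1) (fun i => sg (g.2 i)) (fun i => sg_pm _)
  have hND : ∫ x, H x * T x ∂(gaussianPi p 0) = N * D := by
    simp only [hH, Finset.sum_mul]
    rw [integral_finsetSum]
    · simp only [hDg, Finset.sum_const, Finset.card_univ, nsmul_eq_mul, hcard]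
    · intro g _
      simp only [sub_mul, one_mul]
      exact (hLT _).sub hTi
  have hL2 : ∀ u, MemLp (lrat p u) 2 (gaussianPi p 0) := fun u => by
    rw [memLp_two_iff_integrable_sq (lrat_meas p u).aestronglyMeasurable]
    simpa [sq] using lrat_mul_integrable p u u
  have hH2 : MemLp H 2 (gaussianPi p 0) :=
    memLp_finsetSum _ fun g _ => (hL2 _).sub (memLp_const 1)
  have hHm : Measurable H := by
    refine Finset.measurable_fun_sum _ fun g _ => (lrat_meas _ _).sub_const 1
  have hHT2 : MemLp (fun x => H x * T x) 2 (gaussianPi p 0) :=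
    hH2.of_le (hHm.mul hT.1).aestronglyMeasurable (ae_of_all _ fun x => by
      rw [norm_mul]; exact mul_le_of_le_one_right (norm_nonneg _) (hTb x))
  have hvar := variance_nonneg (fun x => H x * T x) (gaussianPi p 0)
  rw [variance_eq_sub hHT2] at hvar
  have hle : ∫ x, (H x * T x) ^ 2 ∂(gaussianPi p 0) ≤ ∫ x, H x ^ 2 ∂(gaussianPi p 0) := by
    refine integral_mono hHT2.integrable_sq hH2.integrable_sq fun x => ?_
    simp only [mul_pow]
    refine mul_le_of_le_one_right (sq_nonneg _) ?_
    have := hT.2.1 x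
    exact pow_le_one₀ this.1 this.2
  have hpair : ∀ u v, ∫ x, (lrat p u x - 1) * (lrat p v x - 1) ∂(gaussianPi p 0) =
      exp (∑ i, u i * v i) - 1 := by
    intro u v
    have e : ∀ x, (lrat p u x - 1) * (lrat p v x - 1) =
        lrat p u x * lrat p v x - lrat p u x - lrat p v x + 1 := fun x => by ring
    simp_rw [e]
    have i1 : Integrable (fun x => lrat p u x * lrat p v x - lrat p u x) (gaussianPi p 0) :=
      (lrat_mul_integrable p u v).sub (lrat_integrable p u)
    have i2 : Integrable (fun x => lrat p u x * lrat p v x - lrat p u x - lrat p v x)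
      (gaussianPi p 0) := i1.sub (lrat_integrable p v)
    rw [integral_add i2 (integrable_const 1), integral_sub i1 (lrat_integrable p v),
      integral_sub (lrat_mul_integrable p u v) (lrat_integrable p u), lrat_mul_integral,
      lrat_integral, lrat_integral]
    simp
  have hHsq : ∫ x, H x ^ 2 ∂(gaussianPi p 0) =
      ∑ g, ∑ g', (exp (∑ i, act p β g i * act p β g' i) - 1) := by
    have hint : ∀ g g', Integrable (fun x => (lrat p (act p β g) x - 1) *
        (lrat p (act p β g') x - 1)) (gaussianPi p 0) := fun g g' =>
      ((hL2 _).sub (memLp_const 1)).integrable_mul ((hL2 _).sub (memLp_const 1))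
    simp only [hH, sq, Finset.sum_mul_sum]
    rw [integral_finsetSum _ fun g _ => integrable_finsetSum _ fun g' _ => hint g g']
    refine Finset.sum_congr rfl fun g _ => ?_
    rw [integral_finsetSum _ fun g' _ => hint g g']
    exact Finset.sum_congr rfl fun g' _ => hpair _ _
  have hbd : ∫ x, H x ^ 2 ∂(gaussianPi p 0) ≤
      N * (2 ^ p * (A ^ 2 / 2 * exp (A ^ 2 / 2))) := by
    rw [hHsq, ← hcard, ← nsmul_eq_mul, ← Finset.card_univ, ← Finset.sum_const]
    refine Finset.sum_le_sum fun g _ => ?_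
    rw [Finset.sum_sub_distrib]
    have := orbit_sum p β (act p β g) A hβ (by rw [act_sq]; exact hβ)
    simp only [Finset.sum_const, Finset.card_univ, nsmul_eq_mul, mul_one, hcard, hN]
    linarith
  rw [hND] at hvar
  have hfin : (N * D) ^ 2 ≤ N * (2 ^ p * (A ^ 2 / 2 * exp (A ^ 2 / 2))) := by
    have : ∫ x, ((fun x => H x * T x) ^ 2) x ∂(gaussianPi p 0)
      = ∫ x, (H x * T x) ^ 2 ∂(gaussianPi p 0) := rfl
    rw [this] at hvar
    linarith
  rw [le_div_iff₀ hp]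
  have h2 : (0 : ℝ) < 2 ^ p := by positivity
  have hpos : 0 < N * 2 ^ p := by positivity
  refine le_of_mul_le_mul_left ?_ hpos
  calc N * 2 ^ p * (D ^ 2 * p) = (N * D) ^ 2 := by rw [hN]; ring
    _ ≤ _ := hfin
    _ = _ := by ring

/-- For any fixed `Δ > 0`,
`sup_{T ∈ 𝒮_p, ‖β‖₂ ≤ Δ} |Power(T, β) − Level(T)| → 0`: signed-permutation-invariant tests
cannot distinguish `N(0, I_p)` from any alternatives in an `O(1)` Euclidean ball. -/
theorem stmt15 (Δ : ℝ) (hΔ : 0 < Δ) :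
    Tendsto
      (fun p : ℕ =>
        ⨆ q : {q : ((Fin p → ℝ) → ℝ) × (Fin p → ℝ) //
            IsSignedPermInvariantTest p q.1 ∧ Real.sqrt (∑ j, q.2 j ^ 2) ≤ Δ},
          |(∫ x, q.1.1 x ∂(gaussianPi p q.1.2)) - ∫ x, q.1.1 x ∂(gaussianPi p 0)|)
      atTop (nhds 0) := by
  set B : ℝ := (Δ ^ 2) ^ 2 / 2 * exp ((Δ ^ 2) ^ 2 / 2) with hB
  have hlim : Tendsto (fun p : ℕ => Real.sqrt (B / p)) atTop (nhds 0) := by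
    have h := (tendsto_const_div_atTop_nhds_zero_nat B).sqrt
    simpa using h
  refine tendsto_of_tendsto_of_tendsto_of_le_of_le' tendsto_const_nhds hlim ?_ ?_
  · exact Eventually.of_forall fun p => Real.iSup_nonneg fun q => abs_nonneg _
  · filter_upwards [eventually_gt_atTop 0] with p hp
    haveI : NeZero p := ⟨hp.ne'⟩
    refine Real.iSup_le (fun q => ?_) (Real.sqrt_nonneg _)
    obtain ⟨⟨T, β⟩, hT, hβ⟩ := q
    refine Real.abs_le_sqrt ?_
    exact diff_bound p β (Δ ^ 2) ((Real.sqrt_le_left hΔ.le).mp hβ) T hT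
end
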